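/- arXiv:2011.14571 — 2 statements merged into one kernel-verified Lean document; each statement's English description precedes it below -/
import Mathlib

section
/- Suppose M, σ, r, l are positive real constants with rσ² ≥ M². Define V(q) = (M/r)·(1 − ((1−p)/p)^a·(q/(1−q))^a) for q ∈ (0,p). Then for all q ∈ (0,p), V'(q) ≥ −σ²/(M(1−q)q). -/
/-- The derivative of a power of the odds ratio `x / (1 - x)`. -/
theorem hasDerivAt_odds_rpow (a : ℝ) {q : ℝ} (h0 : 0 < q) (h1 : q < 1) :
    HasDerivAt (fun x : ℝ => (x / (1 - x)) ^ a)
      (a * (q / (1 - q)) ^ a / ((1 - q) * q)) q := by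
  have hq : 0 < 1 - q := sub_pos.2 h1
  have hodds : 0 < q / (1 - q) := div_pos h0 hq
  have hdiv := (hasDerivAt_id q).div ((hasDerivAt_id q).const_sub 1) hq.ne'
  refine (hdiv.rpow_const (p := a) (Or.inl hodds.ne')).congr_deriv ?_
  simp only [Pi.div_apply, id]
  rw [Real.rpow_sub_one hodds.ne']
  field_simp
  ring


/-- In the regime `rσ² ≥ M²`, with `p = (1+a)rl/((1+a)rl + aM)`, the function
`V(q) = (M/r)(1 − ((1−p)/p)^a (q/(1−q))^a)` satisfies `V'(q) ≥ −σ²/(M(1−q)q)` on `(0,p)`. -/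
theorem stmt_5 (M σ r l : ℝ) (hM : 0 < M) (hσ : 0 < σ) (hr : 0 < r) (hl : 0 < l)
    (hreg : M ^ 2 ≤ r * σ ^ 2) (a p : ℝ)
    (ha : a = (1 / 2) * (Real.sqrt (1 + 8 * r * σ ^ 2 / M ^ 2) - 1))
    (hp : p = (1 + a) * r * l / ((1 + a) * r * l + a * M))
    (V : ℝ → ℝ)
    (hV : ∀ q, V q = (M / r) * (1 - ((1 - p) / p) ^ a * (q / (1 - q)) ^ a)) :
    ∀ q ∈ Set.Ioo (0:ℝ) p, -σ ^ 2 / (M * (1 - q) * q) ≤ deriv V q := by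
  rintro q ⟨hq0, hqp⟩
  set s := r * σ ^ 2 / M ^ 2 with hs
  have hs1 : 1 ≤ s := (one_le_div (by positivity)).2 hreg
  have ha' : a = (1 / 2) * (Real.sqrt (1 + 8 * s) - 1) := by
    rw [ha, hs]; congr 4; ring
  have hquad : a ^ 2 + a = 2 * s := by
    have := Real.sq_sqrt (show (0 : ℝ) ≤ 1 + 8 * s by linarith)
    rw [ha']; linarith
  have ha1 : 1 ≤ a := by
    have : (3 : ℝ) ≤ Real.sqrt (1 + 8 * s) := Real.le_sqrt_of_sq_le (by linarith)
    linarith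
  have has : a ≤ s := by nlinarith
  have ha0 : 0 < a := by linarith
  have hp1 : p < 1 := by
    rw [hp, div_lt_one (by positivity)]
    linarith [mul_pos ha0 hM]
  have hp0 : 0 < p := hq0.trans hqp
  have h1p : 0 < 1 - p := sub_pos.2 hp1
  have h1q : 0 < 1 - q := by linarith
  have hder : HasDerivAt V
      (-(M / r * a * (((1 - p) / p) ^ a * (q / (1 - q)) ^ a)) / ((1 - q) * q)) q := by
    rw [funext hV]
    refine ((((hasDerivAt_odds_rpow a hq0 (hqp.trans hp1)).const_mul
      (((1 - p) / p) ^ a)).const_sub 1).const_mul (M / r)).congr_deriv ?_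
    ring
  have hpow : ((1 - p) / p) ^ a * (q / (1 - q)) ^ a ≤ 1 := by
    rw [← Real.mul_rpow (by positivity) (by positivity)]
    refine Real.rpow_le_one (by positivity) ?_ ha0.le
    rw [div_mul_div_comm, div_le_one (by positivity)]
    linarith
  have hcoef : M / r * a ≤ σ ^ 2 / M :=
    calc M / r * a ≤ M / r * s := by gcongr
      _ = σ ^ 2 / M := by rw [hs]; field_simp
  rw [hder.deriv, mul_assoc M, ← div_div, neg_div M]
  gcongr
  exact (mul_le_of_le_one_right (by positivity) hpow).trans hcoef
end

section
/- Suppose M, σ, r, l are positive real constants with rσ² < M². Let y : (q*, p) → ℝ be a twice differentiable function satisfying φ(y(q)) = c(p − q)/(p(1 − q)) for all q ∈ (q*, p), and define V(q) = (σ/√r)·y(q). Then V satisfies the differential equation V''(q)/2 − V'(q)/(1−q) − (r/σ²)·V'(q)²·V(q) = 0 for all q ∈ (q*, p). -/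
/-- The Gauss error function `erf x = (2/√π) ∫₀ˣ e^{−t²} dt`. -/
noncomputable def erf (x : ℝ) : ℝ :=
  (2 / Real.sqrt Real.pi) * ∫ t in (0:ℝ)..x, Real.exp (-t ^ 2)

theorem hasDerivAt_erf (x : ℝ) :
    HasDerivAt erf (2 / Real.sqrt Real.pi * Real.exp (-x ^ 2)) x := by
  have hcont : Continuous fun t : ℝ => Real.exp (-t ^ 2) := by fun_prop
  exact (hcont.integral_hasStrictDerivAt 0 x).hasDerivAt.const_mul _

theorem erf_nonneg {x : ℝ} (hx : 0 ≤ x) : 0 ≤ erf x :=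
  mul_nonneg (by positivity)
    (intervalIntegral.integral_nonneg hx fun t _ => (Real.exp_pos _).le)

/-- If `erf ∘ y` is a Möbius function of `q` with pole at `1`, then `y'' = 2 y'/(1-q) + 2 y y'²`. -/
theorem deriv_deriv_of_erf_comp_eq {y : ℝ → ℝ} {s : Set ℝ} {k p : ℝ} (hs : IsOpen s)
    (hs1 : ∀ q ∈ s, q < 1)
    (hy1 : ∀ q ∈ s, DifferentiableAt ℝ y q)
    (hy2 : ∀ q ∈ s, DifferentiableAt ℝ (deriv y) q)
    (herf : ∀ q ∈ s, erf (y q) = k * ((p - q) / (1 - q))) {q : ℝ} (hq : q ∈ s) :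
    deriv (deriv y) q = 2 * deriv y q / (1 - q) + 2 * y q * deriv y q ^ 2 := by
  have hfirst : ∀ x ∈ s, 2 / Real.sqrt Real.pi * Real.exp (-y x ^ 2) * deriv y x * (1 - x) ^ 2
      = k * (p - 1) := by
    intro x hx
    have hx1 : 1 - x ≠ 0 := by linarith [hs1 x hx]
    have hl := (hasDerivAt_erf (y x)).comp x (hy1 x hx).hasDerivAt
    have hr := ((((hasDerivAt_id x).const_sub p).div ((hasDerivAt_id x).const_sub 1) hx1).const_mul
      k).congr_of_eventuallyEq
      (f₁ := erf ∘ y) (Filter.eventually_of_mem (hs.mem_nhds hx) fun z hz => herf z hz)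
    rw [hl.unique hr]
    simp only [id]
    field_simp
    ring
  have hq1 : 1 - q ≠ 0 := by linarith [hs1 q hq]
  have hconst := (hasDerivAt_const q (k * (p - 1))).congr_of_eventuallyEq
    (Filter.eventually_of_mem (hs.mem_nhds hq) hfirst)
  have hprod := ((((((hy1 q hq).hasDerivAt.pow 2).neg).exp.const_mul
    (2 / Real.sqrt Real.pi)).mul (hy2 q hq).hasDerivAt).mul
    (((hasDerivAt_id q).const_sub 1).pow 2))
  have hzero := hprod.unique hconst
  simp only [Pi.mul_apply, Pi.pow_apply, Pi.neg_apply, id] at hzero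
  have hne : 2 / Real.sqrt Real.pi * Real.exp (-y q ^ 2) * (1 - q) ≠ 0 :=
    mul_ne_zero (by positivity) hq1
  have hlin : (1 - q) * deriv (deriv y) q
      = 2 * deriv y q + 2 * y q * deriv y q ^ 2 * (1 - q) := by
    apply mul_left_cancel₀ hne
    linear_combination hzero
  field_simp
  linear_combination hlin

/-- In the regime `rσ² < M²`, with `p = cl√(πr)/(cl√(πr)+σ)` and
`q* = p(c − φ(b))/(c − pφ(b))`, let `y` be twice differentiable on `(q*,p)` with
`φ(y(q)) = c(p−q)/(p(1−q))` there, and set `V(q) = (σ/√r) y(q)`. Then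
`V''/2 − V'/(1−q) − (r/σ²)(V')² V = 0` on `(q*,p)`. -/
theorem stmt_8 (M σ r l : ℝ) (hM : 0 < M) (hσ : 0 < σ) (hr : 0 < r) (hl : 0 < l)
    (hreg : r * σ ^ 2 < M ^ 2) (a b c p qstar : ℝ)
    (ha : a = (1 / 2) * (Real.sqrt (1 + 8 * r * σ ^ 2 / M ^ 2) - 1))
    (hb : b = (1 - a) * M / (2 * σ * Real.sqrt r))
    (hc : c = (2 * σ * Real.sqrt r * Real.exp (-b ^ 2)) / (M * Real.sqrt Real.pi) + erf b)
    (hp : p = c * l * Real.sqrt (Real.pi * r) / (c * l * Real.sqrt (Real.pi * r) + σ))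
    (hqs : qstar = p * (c - erf b) / (c - p * erf b))
    (y : ℝ → ℝ)
    (hy1 : ∀ q ∈ Set.Ioo qstar p, DifferentiableAt ℝ y q)
    (hy2 : ∀ q ∈ Set.Ioo qstar p, DifferentiableAt ℝ (deriv y) q)
    (herf : ∀ q ∈ Set.Ioo qstar p, erf (y q) = c * (p - q) / (p * (1 - q)))
    (V : ℝ → ℝ) (hV : ∀ q, V q = (σ / Real.sqrt r) * y q) :
    ∀ q ∈ Set.Ioo qstar p,
      deriv (deriv V) q / 2 - deriv V q / (1 - q)
        - (r / σ ^ 2) * (deriv V q) ^ 2 * V q = 0 := by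
  have ha1 : a < 1 := by
    have hratio : r * σ ^ 2 / M ^ 2 < 1 := (div_lt_one (by positivity)).2 hreg
    have hsqrt : Real.sqrt (1 + 8 * r * σ ^ 2 / M ^ 2) < 3 := by
      rw [Real.sqrt_lt' (by norm_num)]
      linarith [show 8 * r * σ ^ 2 / M ^ 2 = 8 * (r * σ ^ 2 / M ^ 2) by ring]
    linarith
  have hb0 : 0 ≤ b := by
    have : 0 < 1 - a := by linarith
    rw [hb]
    positivity
  have hc0 : 0 ≤ c := by
    have := erf_nonneg hb0
    rw [hc]
    positivity
  have hp1 : p < 1 := by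
    rw [hp, div_lt_one (by positivity)]
    linarith
  intro q hq
  have hode := deriv_deriv_of_erf_comp_eq (k := c / p) (p := p) isOpen_Ioo
    (fun x hx => hx.2.trans hp1) hy1 hy2
    (fun x hx => by rw [herf x hx, mul_div_mul_comm]) hq
  have hV' : V = fun x => (σ / Real.sqrt r) * y x := funext hV
  have hdV : deriv V = fun x => (σ / Real.sqrt r) * deriv y x := by
    funext x
    rw [hV', deriv_const_mul_field]
  have hddV : deriv (deriv V) q = (σ / Real.sqrt r) * deriv (deriv y) q := by
    rw [hdV, deriv_const_mul_field]
  have hscale : r / σ ^ 2 * (σ / Real.sqrt r) ^ 2 = 1 := by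
    rw [div_pow, Real.sq_sqrt hr.le]
    field_simp
  rw [hddV, hV q, hdV, hode]
  linear_combination (-(σ / Real.sqrt r) * y q * deriv y q ^ 2) * hscale
end
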